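/- Let m be a positive integer, ζ ∈ ℂ a primitive m-th root of unity, x ∈ ℂ, and k ∈ ℕ. Then (1 − x^m)^k · D_ζ(ζ^k x) = ( ∏_{j=0}^{k−1} (1 − ζ^j x) )^m · D_ζ(x). -/

import Mathlib

/-- The cyclic quantum dilogarithm `D_ζ(x) = ∏_{t=1}^{m-1} (1 - ζ^t x)^t`. -/
noncomputable def cyclicDilog (m : ℕ) (ζ x : ℂ) : ℂ :=
  ∏ t ∈ Finset.Icc 1 (m - 1), (1 - ζ ^ t * x) ^ t

theorem IsPrimitiveRoot.one_sub_pow_eq_prod_range {R : Type*} [CommRing R] [IsDomain R]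
    {m : ℕ} (hm : 0 < m) {ζ : R} (hζ : IsPrimitiveRoot ζ m) (x : R) :
    1 - x ^ m = ∏ t ∈ Finset.range m, (1 - ζ ^ t * x) := by
  have h := hζ.pow_sub_pow_eq_prod_sub_mul 1 x hm
  rw [one_pow] at h
  rw [h]
  symm
  refine Finset.prod_nbij (ζ ^ ·) (fun t _ => ?_) (fun a ha b hb hab => ?_) (fun w hw => ?_)
    (fun _ _ => rfl)
  · rw [Polynomial.mem_nthRootsFinset hm, ← pow_mul, mul_comm, pow_mul, hζ.pow_eq_one, one_pow]
  · exact hζ.pow_inj (Finset.mem_range.1 ha) (Finset.mem_range.1 hb) hab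
  · have : NeZero m := ⟨hm.ne'⟩
    obtain ⟨i, hi, rfl⟩ := hζ.eq_pow_of_pow_eq_one
      ((Polynomial.mem_nthRootsFinset hm 1).1 (Finset.mem_coe.1 hw))
    exact ⟨i, by simpa using hi, rfl⟩

theorem cyclicDilog_eq_prod_range {m : ℕ} (hm : 0 < m) (ζ x : ℂ) :
    cyclicDilog m ζ x = ∏ t ∈ Finset.range m, (1 - ζ ^ t * x) ^ t := by
  refine Finset.prod_subset (fun t ht => ?_) (fun t ht ht' => ?_)
  · simp only [Finset.mem_Icc, Finset.mem_range] at *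
    omega
  · simp only [Finset.mem_Icc, Finset.mem_range] at *
    obtain rfl : t = 0 := by omega
    exact pow_zero _

theorem one_sub_pow_mul_cyclicDilog {m : ℕ} (hm : 0 < m) {ζ : ℂ} (hζ : IsPrimitiveRoot ζ m)
    (x : ℂ) :
    (1 - x ^ m) * cyclicDilog m ζ (ζ * x) = (1 - x) ^ m * cyclicDilog m ζ x := by
  have h := hζ.one_sub_pow_eq_prod_range hm (ζ * x)
  rw [mul_pow, hζ.pow_eq_one, one_mul] at h
  have h' := Finset.prod_range_succ' (fun t => (1 - ζ ^ t * x) ^ t) m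
  rw [Finset.prod_range_succ, hζ.pow_eq_one, one_mul, pow_zero, mul_one] at h'
  rw [cyclicDilog_eq_prod_range hm, cyclicDilog_eq_prod_range hm, h, ← Finset.prod_mul_distrib,
    mul_comm ((1 - x) ^ m), h']
  refine Finset.prod_congr rfl fun t _ => ?_
  ring

theorem stmt_7 (m : ℕ) (hm : 0 < m) (ζ : ℂ) (hζ : IsPrimitiveRoot ζ m) (x : ℂ) (k : ℕ) :
    (1 - x ^ m) ^ k * cyclicDilog m ζ (ζ ^ k * x) =
      (∏ j ∈ Finset.range k, (1 - ζ ^ j * x)) ^ m * cyclicDilog m ζ x := by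
  induction k with
  | zero => simp
  | succ k ih =>
    have h := one_sub_pow_mul_cyclicDilog hm hζ (ζ ^ k * x)
    rw [mul_pow, ← pow_mul, mul_comm k m, pow_mul, hζ.pow_eq_one, one_pow, one_mul,
      ← mul_assoc, ← pow_succ'] at h
    rw [pow_succ, mul_assoc, h, Finset.prod_range_succ, mul_pow, mul_left_comm, ih]
    ring
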